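/- arXiv:1605.08982 — 3 statements merged into one kernel-verified Lean document; each statement's English description precedes it below -/
import Mathlib

section
/- Consider the L2-regularized ERM objective P(w) = (1/n) Σ_{j=1}^n φ_j(⟨X_{:j}, w⟩) + (λ/2)‖w‖₂² on ℝ^d, where each φ_j is convex, differentiable and β-smooth, and λ > 0; let w* be its (unique) minimizer. Let p_1, …, p_d > 0 with Σ_i p_i = 1, set u_i := ‖X_{i:}‖₂² (the squared Euclidean norm of the i-th row of X), and for each coordinate i define the update map T_i(w) := w − (n/(β u_i + λ n)) ∂_i P(w) e_i. For a coordinate sequence (i_0, …, i_{k−1}) ∈ {1,…,d}^k let w^k(i_0,…,i_{k−1}) := T_{i_{k−1}} ∘ ⋯ ∘ T_{i_0}(w⁰), and define E[P(w^k)] := Σ over all sequences (i_0,…,i_{k−1}) ∈ {1,…,d}^k of (Π_{t=0}^{k−1} p_{i_t}) · P(w^k(i_0,…,i_{k−1})). Then E[P(w^k)] − P(w*) ≤ (1 − μ)^k (P(w⁰) − P(w*)) with μ := min_{i∈[d]} p_i λ n/(β u_i + λ n). Consequently, for any 0 < ε < P(w⁰) − P(w*), if k ≥ max_{i∈[d]}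 ((β u_i + λ n)/(p_i λ n)) · log((P(w⁰) − P(w*))/ε), then E[P(w^k)] − P(w*) ≤ ε. -/
open scoped BigOperators

/-- The L2-regularized ERM objective `P(w) = (1/n) ∑ⱼ φⱼ(⟨X₍:ⱼ₎, w⟩) + (λ/2)‖w‖₂²`. -/
noncomputable def ermP {d n : ℕ} (X : Matrix (Fin d) (Fin n) ℝ)
    (φ : Fin n → ℝ → ℝ) (lam : ℝ) (w : Fin d → ℝ) : ℝ :=
  (1 / n) * ∑ j, φ j (∑ i, X i j * w i) + lam / 2 * ∑ i, w i ^ 2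

/-- The `i`-th partial derivative of `ermP`. -/
noncomputable def ermGrad {d n : ℕ} (X : Matrix (Fin d) (Fin n) ℝ)
    (φ : Fin n → ℝ → ℝ) (lam : ℝ) (i : Fin d) (w : Fin d → ℝ) : ℝ :=
  (1 / n) * ∑ j, deriv (φ j) (∑ l, X l j * w l) * X i j + lam * w i

/-- The coordinate update map `T i (w) = w − (n/(β uᵢ + λ n)) ∂ᵢP(w) eᵢ`
with `uᵢ = ‖X₍i:₎‖₂²`. -/
noncomputable def ermT {d n : ℕ} (X : Matrix (Fin d) (Fin n) ℝ)
    (φ : Fin n → ℝ → ℝ) (lam β : ℝ) (i : Fin d) (w : Fin d → ℝ) : Fin d → ℝ :=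
  Function.update w i
    (w i - (n / (β * (∑ j, X i j ^ 2) + lam * n)) * ermGrad X φ lam i w)

/-- The iterate `w^k(i₀,…,i_{k−1}) = T_{i_{k−1}} ∘ ⋯ ∘ T_{i₀}(w⁰)`. -/
noncomputable def ermIter {d n : ℕ} (X : Matrix (Fin d) (Fin n) ℝ)
    (φ : Fin n → ℝ → ℝ) (lam β : ℝ) (w0 : Fin d → ℝ) {k : ℕ}
    (σ : Fin k → Fin d) : Fin d → ℝ :=
  (List.ofFn σ).foldl (fun w i => ermT X φ lam β i w) w0

lemma erm_step {d n : ℕ} (hn : 0 < n)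
    (X : Matrix (Fin d) (Fin n) ℝ) (φ : Fin n → ℝ → ℝ) (lam β : ℝ)
    (hsmooth : ∀ j s t, φ j s + deriv (φ j) s * t ≤ φ j (s + t) ∧
        φ j (s + t) ≤ φ j s + deriv (φ j) s * t + β / 2 * t ^ 2)
    (w : Fin d → ℝ) (i : Fin d) (t : ℝ) :
    ermP X φ lam (Function.update w i (w i + t)) ≤ ermP X φ lam w + t * ermGrad X φ lam i w
      + (β * (∑ j, X i j ^ 2) + lam * n) / (2 * n) * t ^ 2 := by
  have hn' : (0 : ℝ) < n := by exact_mod_cast hn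
  have h1 : ∀ j, ∑ l, X l j * Function.update w i (w i + t) l = ∑ l, X l j * w l + X i j * t := by
    intro j
    have : ∀ l, X l j * Function.update w i (w i + t) l
        = X l j * w l + if l = i then X i j * t else 0 := by
      intro l
      by_cases h : l = i
      · subst h; simp; ring
      · simp [h]
    simp [this, Finset.sum_add_distrib]
  have h2 : ∑ l, Function.update w i (w i + t) l ^ 2 = ∑ l, w l ^ 2 + (2 * w i * t + t ^ 2) := by
    have : ∀ l, Function.update w i (w i + t) l ^ 2
        = w l ^ 2 + if l = i then (2 * w i * t + t ^ 2) else 0 := by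
      intro l
      by_cases h : l = i
      · subst h; simp; ring
      · simp [h]
    simp [this, Finset.sum_add_distrib]
  have h3 : ∑ j, φ j (∑ l, X l j * w l + X i j * t) ≤ ∑ j, φ j (∑ l, X l j * w l)
      + t * ∑ j, deriv (φ j) (∑ l, X l j * w l) * X i j
      + β / 2 * t ^ 2 * ∑ j, X i j ^ 2 := by
    rw [Finset.mul_sum, Finset.mul_sum, ← Finset.sum_add_distrib, ← Finset.sum_add_distrib]
    refine Finset.sum_le_sum fun j _ => ?_
    refine ((hsmooth j _ _).2).trans (le_of_eq ?_)
    ring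
  have h4 := mul_le_mul_of_nonneg_left h3 (show (0 : ℝ) ≤ 1 / n by positivity)
  unfold ermP ermGrad
  simp only [h1, h2]
  have h5 : (β * (∑ j, X i j ^ 2) + lam * n) / (2 * n) * t ^ 2
      = (1 / n) * (β / 2 * t ^ 2 * ∑ j, X i j ^ 2) + lam / 2 * t ^ 2 := by
    field_simp
  rw [h5]
  linarith

lemma erm_descent {d n : ℕ} (hn : 0 < n)
    (X : Matrix (Fin d) (Fin n) ℝ) (φ : Fin n → ℝ → ℝ) (lam β : ℝ)
    (hlam : 0 < lam) (hβ : 0 < β)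
    (hsmooth : ∀ j s t, φ j s + deriv (φ j) s * t ≤ φ j (s + t) ∧
        φ j (s + t) ≤ φ j s + deriv (φ j) s * t + β / 2 * t ^ 2)
    (w : Fin d → ℝ) (i : Fin d) :
    ermP X φ lam (ermT X φ lam β i w) ≤ ermP X φ lam w
      - n / (2 * (β * (∑ j, X i j ^ 2) + lam * n)) * ermGrad X φ lam i w ^ 2 := by
  have hn' : (0 : ℝ) < n := by exact_mod_cast hn
  have hu : 0 ≤ ∑ j, X i j ^ 2 := Finset.sum_nonneg fun j _ => sq_nonneg _
  have hD : 0 < β * (∑ j, X i j ^ 2) + lam * n := by positivity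
  have h := erm_step hn X φ lam β hsmooth w i
    (-((n / (β * (∑ j, X i j ^ 2) + lam * n)) * ermGrad X φ lam i w))
  unfold ermT
  rw [sub_eq_add_neg]
  refine h.trans (le_of_eq ?_)
  generalize β * (∑ j, X i j ^ 2) + lam * n = D at *
  field_simp
  ring

lemma erm_strong {d n : ℕ} (hn : 0 < n)
    (X : Matrix (Fin d) (Fin n) ℝ) (φ : Fin n → ℝ → ℝ) (lam β : ℝ)
    (hlam : 0 < lam)
    (hsmooth : ∀ j s t, φ j s + deriv (φ j) s * t ≤ φ j (s + t) ∧
        φ j (s + t) ≤ φ j s + deriv (φ j) s * t + β / 2 * t ^ 2)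
    (w v : Fin d → ℝ) :
    ermP X φ lam w - ermP X φ lam v ≤ 1 / (2 * lam) * ∑ i, ermGrad X φ lam i w ^ 2 := by
  have hn' : (0 : ℝ) < n := by exact_mod_cast hn
  have h1 : ∑ j, φ j (∑ l, X l j * w l)
      + ∑ i, (∑ j, deriv (φ j) (∑ l, X l j * w l) * X i j) * (v i - w i)
      ≤ ∑ j, φ j (∑ l, X l j * v l) := by
    simp only [Finset.sum_mul]
    rw [Finset.sum_comm, ← Finset.sum_add_distrib]
    refine Finset.sum_le_sum fun j _ => ?_
    have := (hsmooth j (∑ l, X l j * w l) (∑ l, X l j * (v l - w l))).1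
    rw [← Finset.sum_add_distrib, Finset.mul_sum] at this
    have e1 : ∀ l, X l j * w l + X l j * (v l - w l) = X l j * v l := fun l => by ring
    simp only [e1, ← mul_assoc] at this
    exact this
  have h2 := mul_le_mul_of_nonneg_left h1 (show (0 : ℝ) ≤ 1 / n by positivity)
  have h3 : (1 / (n : ℝ)) * (∑ i, (∑ j, deriv (φ j) (∑ l, X l j * w l) * X i j) * (v i - w i))
      + lam / 2 * ∑ i, v i ^ 2 - lam / 2 * ∑ i, w i ^ 2
      + 1 / (2 * lam) * ∑ i, ermGrad X φ lam i w ^ 2 ≥ 0 := by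
    simp only [Finset.mul_sum]
    rw [← Finset.sum_add_distrib, ← Finset.sum_sub_distrib, ← Finset.sum_add_distrib]
    refine Finset.sum_nonneg fun i _ => ?_
    unfold ermGrad
    generalize ∑ j, deriv (φ j) (∑ l, X l j * w l) * X i j = g
    have : 1 / (n : ℝ) * (g * (v i - w i)) + lam / 2 * v i ^ 2 - lam / 2 * w i ^ 2
        + 1 / (2 * lam) * (1 / n * g + lam * w i) ^ 2
        = 1 / (2 * lam) * ((1 / n * g + lam * w i) + lam * (v i - w i)) ^ 2 := by
      field_simp
      ring
    rw [this]
    positivity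
  unfold ermP
  linarith

lemma erm_contract {d n : ℕ} (hn : 0 < n)
    (X : Matrix (Fin d) (Fin n) ℝ) (φ : Fin n → ℝ → ℝ) (lam β : ℝ)
    (hlam : 0 < lam) (hβ : 0 < β)
    (hsmooth : ∀ j s t, φ j s + deriv (φ j) s * t ≤ φ j (s + t) ∧
        φ j (s + t) ≤ φ j s + deriv (φ j) s * t + β / 2 * t ^ 2)
    (p : Fin d → ℝ) (hp : ∀ i, 0 < p i) (hp1 : ∑ i, p i = 1) (μ : ℝ) (hμ0 : 0 ≤ μ)
    (hμ : ∀ i, μ ≤ p i * lam * n / (β * (∑ j, X i j ^ 2) + lam * n))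
    (w v : Fin d → ℝ) :
    ∑ i, p i * (ermP X φ lam (ermT X φ lam β i w) - ermP X φ lam v)
      ≤ (1 - μ) * (ermP X φ lam w - ermP X φ lam v) := by
  have hn' : (0 : ℝ) < n := by exact_mod_cast hn
  have h1 : ∑ i, p i * (ermP X φ lam (ermT X φ lam β i w) - ermP X φ lam v)
      ≤ ∑ i, (p i * (ermP X φ lam w - ermP X φ lam v)
        - μ * (1 / (2 * lam) * ermGrad X φ lam i w ^ 2)) := by
    refine Finset.sum_le_sum fun i _ => ?_
    have hu : 0 ≤ ∑ j, X i j ^ 2 := Finset.sum_nonneg fun j _ => sq_nonneg _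
    have hD : 0 < β * (∑ j, X i j ^ 2) + lam * n := by positivity
    have ha := mul_le_mul_of_nonneg_left
      (erm_descent hn X φ lam β hlam hβ hsmooth w i) (hp i).le
    have hb := mul_le_mul_of_nonneg_right (hμ i)
      (show 0 ≤ 1 / (2 * lam) * ermGrad X φ lam i w ^ 2 by positivity)
    generalize β * (∑ j, X i j ^ 2) + lam * n = D at *
    have hc : p i * lam * n / D * (1 / (2 * lam) * ermGrad X φ lam i w ^ 2)
        = p i * (n / (2 * D) * ermGrad X φ lam i w ^ 2) := by
      field_simp
    rw [hc] at hb
    linarith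
  rw [Finset.sum_sub_distrib, ← Finset.sum_mul, hp1, ← Finset.mul_sum, ← Finset.mul_sum] at h1
  have h2 := mul_le_mul_of_nonneg_left (erm_strong hn X φ lam β hlam hsmooth w v) hμ0
  linarith

lemma erm_succ {d n : ℕ}
    (X : Matrix (Fin d) (Fin n) ℝ) (φ : Fin n → ℝ → ℝ) (lam β : ℝ)
    (p : Fin d → ℝ) (w0 : Fin d → ℝ) (k : ℕ) :
    (∑ σ : Fin (k + 1) → Fin d, (∏ t, p (σ t)) * ermP X φ lam (ermIter X φ lam β w0 σ))
    = ∑ i, p i * ∑ σ : Fin k → Fin d, (∏ t, p (σ t)) *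
        ermP X φ lam (ermIter X φ lam β (ermT X φ lam β i w0) σ) := by
  rw [← (Fin.consEquiv (fun _ : Fin (k + 1) => Fin d)).sum_comp, Fintype.sum_prod_type]
  refine Finset.sum_congr rfl fun i _ => ?_
  rw [Finset.mul_sum]
  refine Finset.sum_congr rfl fun σ _ => ?_
  simp [Fin.consEquiv, Fin.prod_univ_succ, ermIter, List.ofFn_succ, mul_assoc]

lemma erm_geom {d n : ℕ} (hn : 0 < n)
    (X : Matrix (Fin d) (Fin n) ℝ) (φ : Fin n → ℝ → ℝ) (lam β : ℝ)
    (hlam : 0 < lam) (hβ : 0 < β)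
    (hsmooth : ∀ j s t, φ j s + deriv (φ j) s * t ≤ φ j (s + t) ∧
        φ j (s + t) ≤ φ j s + deriv (φ j) s * t + β / 2 * t ^ 2)
    (p : Fin d → ℝ) (hp : ∀ i, 0 < p i) (hp1 : ∑ i, p i = 1) (μ : ℝ) (hμ0 : 0 ≤ μ)
    (hμ1 : μ ≤ 1)
    (hμ : ∀ i, μ ≤ p i * lam * n / (β * (∑ j, X i j ^ 2) + lam * n))
    (v : Fin d → ℝ) (k : ℕ) : ∀ w0 : Fin d → ℝ,
    (∑ σ : Fin k → Fin d, (∏ t, p (σ t)) * ermP X φ lam (ermIter X φ lam β w0 σ))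
          - ermP X φ lam v
        ≤ (1 - μ) ^ k * (ermP X φ lam w0 - ermP X φ lam v) := by
  induction k with
  | zero => intro w0; simp [ermIter]
  | succ k ih =>
    intro w0
    rw [erm_succ]
    have h1 : ∀ c : ℝ, c = ∑ i, p i * c := by
      intro c; rw [← Finset.sum_mul, hp1, one_mul]
    rw [h1 (ermP X φ lam v), ← Finset.sum_sub_distrib, ← h1 (ermP X φ lam v)]
    simp only [← mul_sub]
    calc _ ≤ ∑ i, p i * ((1 - μ) ^ k *
          (ermP X φ lam (ermT X φ lam β i w0) - ermP X φ lam v)) :=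
          Finset.sum_le_sum fun i _ => mul_le_mul_of_nonneg_left (ih _) (hp i).le
      _ = (1 - μ) ^ k * ∑ i, p i *
          (ermP X φ lam (ermT X φ lam β i w0) - ermP X φ lam v) := by
          rw [Finset.mul_sum]
          exact Finset.sum_congr rfl fun i _ => by ring
      _ ≤ (1 - μ) ^ k * ((1 - μ) * (ermP X φ lam w0 - ermP X φ lam v)) :=
          mul_le_mul_of_nonneg_left
            (erm_contract hn X φ lam β hlam hβ hsmooth p hp hp1 μ hμ0 hμ w0 v)
            (pow_nonneg (by linarith) k)
      _ = _ := by ring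

/-- Complexity of primal RCD (NSync) with a serial sampling `p` applied to the
L2-regularized ERM problem with convex, differentiable, `β`-smooth losses:
the expected primal suboptimality contracts geometrically with factor
`1 − μ`, `μ = minᵢ pᵢ λ n/(β uᵢ + λ n)`, and consequently
`k ≥ maxᵢ ((β uᵢ + λ n)/(pᵢ λ n)) log((P(w⁰) − P(w*))/ε)` iterations suffice
to drive the expected suboptimality below `ε`. -/
theorem primal_rcd_complexity
    (d n : ℕ) (hd : 0 < d) (hn : 0 < n)
    (X : Matrix (Fin d) (Fin n) ℝ) (φ : Fin n → ℝ → ℝ) (lam β : ℝ)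
    (hlam : 0 < lam) (hβ : 0 < β)
    (hconv : ∀ j, ConvexOn ℝ Set.univ (φ j))
    (hdiff : ∀ j, Differentiable ℝ (φ j))
    (hsmooth : ∀ j s t, φ j s + deriv (φ j) s * t ≤ φ j (s + t) ∧
        φ j (s + t) ≤ φ j s + deriv (φ j) s * t + β / 2 * t ^ 2)
    (wstar : Fin d → ℝ) (hmin : ∀ w, ermP X φ lam wstar ≤ ermP X φ lam w)
    (p : Fin d → ℝ) (hp : ∀ i, 0 < p i) (hp1 : ∑ i, p i = 1)
    (w0 : Fin d → ℝ)
    (μ : ℝ)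
    (hμ : μ = Finset.univ.inf' ⟨⟨0, hd⟩, Finset.mem_univ _⟩
        fun i => p i * lam * n / (β * (∑ j, X i j ^ 2) + lam * n)) :
    (∀ k : ℕ,
      (∑ σ : Fin k → Fin d, (∏ t, p (σ t)) * ermP X φ lam (ermIter X φ lam β w0 σ))
          - ermP X φ lam wstar
        ≤ (1 - μ) ^ k * (ermP X φ lam w0 - ermP X φ lam wstar)) ∧
    (∀ ε : ℝ, 0 < ε → ε < ermP X φ lam w0 - ermP X φ lam wstar →
      ∀ k : ℕ,
        (Finset.univ.sup' ⟨⟨0, hd⟩, Finset.mem_univ _⟩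
            fun i => (β * (∑ j, X i j ^ 2) + lam * n) / (p i * lam * n)) *
          Real.log ((ermP X φ lam w0 - ermP X φ lam wstar) / ε) ≤ (k : ℝ) →
        (∑ σ : Fin k → Fin d, (∏ t, p (σ t)) * ermP X φ lam (ermIter X φ lam β w0 σ))
            - ermP X φ lam wstar ≤ ε) := by
  have hn' : (0 : ℝ) < n := by exact_mod_cast hn
  have hD : ∀ i, 0 < β * (∑ j, X i j ^ 2) + lam * n := by
    intro i
    have hu : 0 ≤ ∑ j, X i j ^ 2 := Finset.sum_nonneg fun j _ => sq_nonneg _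
    positivity
  have hμle : ∀ i, μ ≤ p i * lam * n / (β * (∑ j, X i j ^ 2) + lam * n) := by
    intro i
    rw [hμ]
    exact Finset.inf'_le _ (Finset.mem_univ i)
  obtain ⟨i0, -, hi0⟩ := Finset.exists_mem_eq_inf' (s := (Finset.univ : Finset (Fin d)))
    ⟨⟨0, hd⟩, Finset.mem_univ _⟩
    (fun i => p i * lam * n / (β * (∑ j, X i j ^ 2) + lam * n))
  rw [← hμ] at hi0
  have hμ0 : 0 < μ := by
    rw [hi0]
    exact div_pos (mul_pos (mul_pos (hp i0) hlam) hn') (hD i0)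
  have hμ1 : μ ≤ 1 := by
    have hpi : p i0 ≤ 1 := by
      rw [← hp1]
      exact Finset.single_le_sum (fun i _ => (hp i).le) (Finset.mem_univ i0)
    have hu : 0 ≤ ∑ j, X i0 j ^ 2 := Finset.sum_nonneg fun j _ => sq_nonneg _
    rw [hi0, div_le_one (hD i0)]
    nlinarith [mul_nonneg hβ.le hu, mul_le_mul_of_nonneg_right hpi (mul_pos hlam hn').le]
  have hgeom := fun k => erm_geom hn X φ lam β hlam hβ hsmooth p hp hp1 μ hμ0.le hμ1 hμle wstar k w0
  refine ⟨hgeom, ?_⟩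
  intro ε hε hlt k hk
  refine (hgeom k).trans ?_
  generalize ermP X φ lam w0 - ermP X φ lam wstar = Δ at *
  have hΔ : 0 < Δ := hε.trans hlt
  have hlog : 0 ≤ Real.log (Δ / ε) := Real.log_nonneg (by rw [le_div_iff₀ hε]; linarith)
  have hM : 1 / μ ≤ Finset.univ.sup' ⟨⟨0, hd⟩, Finset.mem_univ _⟩
      fun i => (β * (∑ j, X i j ^ 2) + lam * n) / (p i * lam * n) := by
    have := Finset.le_sup' (s := (Finset.univ : Finset (Fin d)))
      (fun i => (β * (∑ j, X i j ^ 2) + lam * n) / (p i * lam * n)) (Finset.mem_univ i0)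
    refine le_trans (le_of_eq ?_) this
    rw [hi0, one_div_div]
  have h1 : 1 / μ * Real.log (Δ / ε) ≤ k := (mul_le_mul_of_nonneg_right hM hlog).trans hk
  have h2 : Real.log (Δ / ε) ≤ μ * k := by
    rw [one_div, inv_mul_le_iff₀ hμ0] at h1
    exact h1
  have h3 : (1 - μ) ^ k ≤ Real.exp (-(μ * k)) := by
    calc (1 - μ) ^ k ≤ (Real.exp (-μ)) ^ k :=
          pow_le_pow_left₀ (by linarith) (Real.one_sub_le_exp_neg μ) k
      _ = _ := by rw [← Real.exp_nat_mul]; ring_nf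
  have h4 : Real.exp (-(μ * k)) ≤ ε / Δ := by
    calc Real.exp (-(μ * k)) ≤ Real.exp (-Real.log (Δ / ε)) := Real.exp_le_exp.2 (by linarith)
      _ = ε / Δ := by
        rw [Real.exp_neg, Real.exp_log (by positivity), inv_div]
  calc (1 - μ) ^ k * Δ ≤ ε / Δ * Δ := mul_le_mul_of_nonneg_right (h3.trans h4) hΔ.le
    _ = ε := by field_simp
end

section
/- Fix d ≥ 1, positive reals s_1, …, s_d (in the paper, s_i = β u_i + λ n) and nonnegative reals c_1, …, c_d not all zero (in the paper, c_i = ‖X_{i:}‖₀). For a probability vector p (p_i > 0, Σ_i p_i = 1) define the total complexity T(p) := (max_{i∈[d]} s_i/p_i) · (Σ_{i=1}^d p_i c_i). Then the importance sampling p*_i := s_i / Σ_{l=1}^d s_l minimizes T over all such probability vectors: for every probability vector p with positive entries, T(p) ≥ T(p*) = Σ_{i=1}^d s_i c_i. -/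
open scoped BigOperators

/-- The total complexity `T(p) = (maxᵢ sᵢ/pᵢ) · ∑ᵢ pᵢ cᵢ` of RCD with serial
sampling probabilities `p`. -/
noncomputable def totalComplexity {d : ℕ} (hd : 0 < d) (s c p : Fin d → ℝ) : ℝ :=
  (Finset.univ.sup' ⟨⟨0, hd⟩, Finset.mem_univ _⟩ fun i => s i / p i) * ∑ i, p i * c i

/-- The importance sampling `p*ᵢ = sᵢ/∑ₗ sₗ` minimizes the total complexity
`T(p) = (maxᵢ sᵢ/pᵢ) · ∑ᵢ pᵢ cᵢ` over all probability vectors with positive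
entries, and its total complexity equals `∑ᵢ sᵢ cᵢ`. -/
theorem importance_sampling_minimizes_total_complexity
    (d : ℕ) (hd : 0 < d) (s c : Fin d → ℝ)
    (hs : ∀ i, 0 < s i) (hc : ∀ i, 0 ≤ c i) (hc0 : ∃ i, c i ≠ 0)
    (pstar : Fin d → ℝ) (hpstar : ∀ i, pstar i = s i / ∑ l, s l) :
    totalComplexity hd s c pstar = ∑ i, s i * c i ∧
    ∀ p : Fin d → ℝ, (∀ i, 0 < p i) → ∑ i, p i = 1 →
      totalComplexity hd s c pstar ≤ totalComplexity hd s c p := by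
  have hS : 0 < ∑ l, s l :=
    Finset.sum_pos (fun i _ => hs i) ⟨⟨0, hd⟩, Finset.mem_univ _⟩
  have key : totalComplexity hd s c pstar = ∑ i, s i * c i := by
    unfold totalComplexity
    have h1 : (fun i => s i / pstar i) = fun _ => ∑ l, s l := by
      funext i
      rw [hpstar i]
      have := (hs i).ne'
      field_simp
    have hne : (Finset.univ : Finset (Fin d)).Nonempty := ⟨⟨0, hd⟩, Finset.mem_univ _⟩
    have h2 : Finset.univ.sup' hne (fun i => s i / pstar i) = ∑ l, s l := by
      rw [h1, Finset.sup'_const]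
    change Finset.univ.sup' hne (fun i => s i / pstar i) * _ = _
    rw [h2, Finset.mul_sum]
    refine Finset.sum_congr rfl fun i _ => ?_
    rw [hpstar i]
    field_simp
  refine ⟨key, fun p hp _ => ?_⟩
  rw [key]
  unfold totalComplexity
  rw [Finset.mul_sum]
  refine Finset.sum_le_sum fun i _ => ?_
  rw [← mul_assoc]
  refine mul_le_mul_of_nonneg_right ?_ (hc i)
  rw [← div_le_iff₀ (hp i)]
  exact Finset.le_sup' (fun i => s i / p i) (Finset.mem_univ i)
end

section
/- Let d ≥ 2 and n ≥ 2. The bounds 1/d ≤ C_P(X)/C_D(X) ≤ n over matrices X ∈ ℝ^{d×n} with no zero rows or columns are tight in the following sense: for every ε > 0 there exists a matrix X ∈ ℝ^{d×n} with no zero row and no zero column such that C_P(X)/C_D(X) < 1/d + ε, and there exists a matrix X' ∈ ℝ^{d×n} with no zero row and no zero column such that C_P(X')/C_D(X') > n − ε. In particular, for the matrix X(a,b,c) defined by X_{i1} = a for i ≠ 1, X_{1j} = b for j ≠ 1, X_{11} = c and all other entries zero (with a, b, c nonzero reals), one has C_P(X(a,b,c)) = (d−1)a² + n(n−1)b² +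 n c² and C_D(X(a,b,c)) = d(d−1)a² + (n−1)b² + d c², so the ratio tends to 1/d as (b,c) → (0,0) and to n as (a,c) → (0,0). -/
open scoped BigOperators Topology

/-- Number of nonzero entries of row `i` of `X`. -/
noncomputable def nnzRow {d n : ℕ} (X : Matrix (Fin d) (Fin n) ℝ) (i : Fin d) : ℕ :=
  (Finset.univ.filter fun j => X i j ≠ 0).card

/-- Number of nonzero entries of column `j` of `X`. -/
noncomputable def nnzCol {d n : ℕ} (X : Matrix (Fin d) (Fin n) ℝ) (j : Fin n) : ℕ :=
  (Finset.univ.filter fun i => X i j ≠ 0).card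

/-- `C_P(X) = ∑ᵢ ‖X₍i:₎‖₀ ‖X₍i:₎‖₂²`. -/
noncomputable def CP {d n : ℕ} (X : Matrix (Fin d) (Fin n) ℝ) : ℝ :=
  ∑ i, (nnzRow X i : ℝ) * ∑ j, X i j ^ 2

/-- `C_D(X) = ∑ⱼ ‖X₍:j₎‖₀ ‖X₍:j₎‖₂²`. -/
noncomputable def CD {d n : ℕ} (X : Matrix (Fin d) (Fin n) ℝ) : ℝ :=
  ∑ j, (nnzCol X j : ℝ) * ∑ i, X i j ^ 2

/-- The matrix `X(a,b,c)` whose first column is filled with `a` (except the top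
entry), first row filled with `b` (except the left entry), top-left entry `c`,
and all remaining entries zero. -/
def Xabc (d n : ℕ) (a b c : ℝ) : Matrix (Fin d) (Fin n) ℝ :=
  fun i j =>
    if i.val = 0 then (if j.val = 0 then c else b)
    else (if j.val = 0 then a else 0)

theorem CP_Xabc_aux (d n : ℕ) (a b c : ℝ) (ha : a ≠ 0) (hb : b ≠ 0) (hc : c ≠ 0) :
    CP (Xabc (d+1) (n+1) a b c) = (d : ℝ) * a ^ 2 + (n+1) * n * b ^ 2 + (n+1) * c ^ 2 := by
  simp [CP, nnzRow, Xabc, Finset.card_filter, Fin.sum_univ_succ, ha, hb, hc]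
  ring

theorem CD_Xabc_aux (d n : ℕ) (a b c : ℝ) (ha : a ≠ 0) (hb : b ≠ 0) (hc : c ≠ 0) :
    CD (Xabc (d+1) (n+1) a b c) = (d+1) * (d : ℝ) * a ^ 2 + n * b ^ 2 + (d+1) * c ^ 2 := by
  simp [CD, nnzCol, Xabc, Finset.card_filter, Fin.sum_univ_succ, ha, hb, hc]
  ring

theorem neBot_aux : (𝓝[{bc : ℝ × ℝ | bc.1 ≠ 0 ∧ bc.2 ≠ 0}] ((0 : ℝ), (0 : ℝ))).NeBot := by
  have h : {bc : ℝ × ℝ | bc.1 ≠ 0 ∧ bc.2 ≠ 0} = ({0}ᶜ : Set ℝ) ×ˢ ({0}ᶜ : Set ℝ) := by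
    ext x; simp
  rw [h, nhdsWithin_prod_eq]
  infer_instance

/-- Tightness of the bounds `1/d ≤ C_P/C_D ≤ n`: for every `ε > 0` there are
matrices with no zero rows or columns whose ratio is below `1/d + ε`
(resp. above `n − ε`); moreover for the explicit family `X(a,b,c)` one has
`C_P = (d−1)a² + n(n−1)b² + nc²`, `C_D = d(d−1)a² + (n−1)b² + dc²`, so the ratio
tends to `1/d` as `(b,c) → (0,0)` and to `n` as `(a,c) → (0,0)`
(through nonzero values). -/
theorem CP_CD_bounds_tight
    (d n : ℕ) (hd : 2 ≤ d) (hn : 2 ≤ n) :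
    (∀ ε : ℝ, 0 < ε → ∃ X : Matrix (Fin d) (Fin n) ℝ,
      (∀ i, ∃ j, X i j ≠ 0) ∧ (∀ j, ∃ i, X i j ≠ 0) ∧
      CP X / CD X < 1 / (d : ℝ) + ε) ∧
    (∀ ε : ℝ, 0 < ε → ∃ X : Matrix (Fin d) (Fin n) ℝ,
      (∀ i, ∃ j, X i j ≠ 0) ∧ (∀ j, ∃ i, X i j ≠ 0) ∧
      (n : ℝ) - ε < CP X / CD X) ∧
    (∀ a b c : ℝ, a ≠ 0 → b ≠ 0 → c ≠ 0 →
      (∀ i, ∃ j, Xabc d n a b c i j ≠ 0) ∧ (∀ j, ∃ i, Xabc d n a b c i j ≠ 0) ∧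
      CP (Xabc d n a b c) = ((d : ℝ) - 1) * a ^ 2 + n * ((n : ℝ) - 1) * b ^ 2 + n * c ^ 2 ∧
      CD (Xabc d n a b c) = d * ((d : ℝ) - 1) * a ^ 2 + ((n : ℝ) - 1) * b ^ 2 + d * c ^ 2) ∧
    (∀ a : ℝ, a ≠ 0 →
      Filter.Tendsto
        (fun bc : ℝ × ℝ => CP (Xabc d n a bc.1 bc.2) / CD (Xabc d n a bc.1 bc.2))
        (𝓝[{bc : ℝ × ℝ | bc.1 ≠ 0 ∧ bc.2 ≠ 0}] (0, 0)) (𝓝 (1 / (d : ℝ)))) ∧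
    (∀ b : ℝ, b ≠ 0 →
      Filter.Tendsto
        (fun ac : ℝ × ℝ => CP (Xabc d n ac.1 b ac.2) / CD (Xabc d n ac.1 b ac.2))
        (𝓝[{ac : ℝ × ℝ | ac.1 ≠ 0 ∧ ac.2 ≠ 0}] (0, 0)) (𝓝 (n : ℝ))) := by
  have key : ∀ a b c : ℝ, a ≠ 0 → b ≠ 0 → c ≠ 0 →
      (∀ i, ∃ j, Xabc d n a b c i j ≠ 0) ∧ (∀ j, ∃ i, Xabc d n a b c i j ≠ 0) ∧
      CP (Xabc d n a b c) = ((d : ℝ) - 1) * a ^ 2 + n * ((n : ℝ) - 1) * b ^ 2 + n * c ^ 2 ∧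
      CD (Xabc d n a b c) = d * ((d : ℝ) - 1) * a ^ 2 + ((n : ℝ) - 1) * b ^ 2 + d * c ^ 2 := by
    intro a b c ha hb hc
    obtain ⟨d, rfl⟩ : ∃ k, d = k + 1 := ⟨d - 1, by omega⟩
    obtain ⟨n, rfl⟩ : ∃ k, n = k + 1 := ⟨n - 1, by omega⟩
    refine ⟨fun i => ⟨0, ?_⟩, fun j => ⟨0, ?_⟩, ?_, ?_⟩
    · simp only [Xabc]; split_ifs <;> simp_all
    · simp only [Xabc]; split_ifs <;> simp_all
    · rw [CP_Xabc_aux d n a b c ha hb hc]; push_cast; ring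
    · rw [CD_Xabc_aux d n a b c ha hb hc]; push_cast; ring
  have hd' : (2 : ℝ) ≤ d := by exact_mod_cast hd
  have hn' : (2 : ℝ) ≤ n := by exact_mod_cast hn
  have hd0 : (d : ℝ) ≠ 0 := by linarith
  have hd1 : (d : ℝ) - 1 ≠ 0 := by intro h; linarith
  have hn1 : (n : ℝ) - 1 ≠ 0 := by intro h; linarith
  have T1 : ∀ a : ℝ, a ≠ 0 →
      Filter.Tendsto
        (fun bc : ℝ × ℝ => CP (Xabc d n a bc.1 bc.2) / CD (Xabc d n a bc.1 bc.2))
        (𝓝[{bc : ℝ × ℝ | bc.1 ≠ 0 ∧ bc.2 ≠ 0}] (0, 0)) (𝓝 (1 / (d : ℝ))) := by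
    intro a ha
    have hc : ContinuousAt (fun x : ℝ × ℝ =>
        (((d : ℝ) - 1) * a ^ 2 + n * ((n : ℝ) - 1) * x.1 ^ 2 + n * x.2 ^ 2) /
        (d * ((d : ℝ) - 1) * a ^ 2 + ((n : ℝ) - 1) * x.1 ^ 2 + d * x.2 ^ 2)) (0, 0) := by
      apply ContinuousAt.div
      · fun_prop
      · fun_prop
      · simp [hd0, hd1, ha]
    have h2 := hc.tendsto.mono_left
      (nhdsWithin_le_nhds (s := {bc : ℝ × ℝ | bc.1 ≠ 0 ∧ bc.2 ≠ 0}))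
    have e : (((d : ℝ) - 1) * a ^ 2 + n * ((n : ℝ) - 1) * (0 : ℝ) ^ 2 + n * (0 : ℝ) ^ 2) /
        (d * ((d : ℝ) - 1) * a ^ 2 + ((n : ℝ) - 1) * (0 : ℝ) ^ 2 + d * (0 : ℝ) ^ 2)
        = 1 / (d : ℝ) := by
      simp only [ne_eq, OfNat.ofNat_ne_zero, not_false_eq_true, zero_pow, mul_zero, add_zero]
      field_simp
    simp only [e] at h2
    refine h2.congr' ?_
    filter_upwards [self_mem_nhdsWithin] with x hx
    obtain ⟨-, -, h3, h4⟩ := key a x.1 x.2 ha hx.1 hx.2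
    rw [h3, h4]
  have T2 : ∀ b : ℝ, b ≠ 0 →
      Filter.Tendsto
        (fun ac : ℝ × ℝ => CP (Xabc d n ac.1 b ac.2) / CD (Xabc d n ac.1 b ac.2))
        (𝓝[{ac : ℝ × ℝ | ac.1 ≠ 0 ∧ ac.2 ≠ 0}] (0, 0)) (𝓝 (n : ℝ)) := by
    intro b hb
    have hc : ContinuousAt (fun x : ℝ × ℝ =>
        (((d : ℝ) - 1) * x.1 ^ 2 + n * ((n : ℝ) - 1) * b ^ 2 + n * x.2 ^ 2) /
        (d * ((d : ℝ) - 1) * x.1 ^ 2 + ((n : ℝ) - 1) * b ^ 2 + d * x.2 ^ 2)) (0, 0) := by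
      apply ContinuousAt.div
      · fun_prop
      · fun_prop
      · simp [hn1, hb]
    have h2 := hc.tendsto.mono_left
      (nhdsWithin_le_nhds (s := {bc : ℝ × ℝ | bc.1 ≠ 0 ∧ bc.2 ≠ 0}))
    have e : (((d : ℝ) - 1) * (0 : ℝ) ^ 2 + n * ((n : ℝ) - 1) * b ^ 2 + n * (0 : ℝ) ^ 2) /
        (d * ((d : ℝ) - 1) * (0 : ℝ) ^ 2 + ((n : ℝ) - 1) * b ^ 2 + d * (0 : ℝ) ^ 2)
        = (n : ℝ) := by
      simp only [ne_eq, OfNat.ofNat_ne_zero, not_false_eq_true, zero_pow, mul_zero, add_zero,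
        zero_add]
      field_simp
    simp only [e] at h2
    refine h2.congr' ?_
    filter_upwards [self_mem_nhdsWithin] with x hx
    obtain ⟨-, -, h3, h4⟩ := key x.1 b x.2 hx.1 hb hx.2
    rw [h3, h4]
  haveI := neBot_aux
  refine ⟨?_, ?_, key, T1, T2⟩
  · intro ε hε
    have h := (T1 1 one_ne_zero).eventually_lt_const (show 1 / (d : ℝ) < 1 / (d : ℝ) + ε by linarith)
    obtain ⟨x, hx, hm⟩ := (h.and self_mem_nhdsWithin).exists
    obtain ⟨h1, h2, -, -⟩ := key 1 x.1 x.2 one_ne_zero hm.1 hm.2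
    exact ⟨_, h1, h2, hx⟩
  · intro ε hε
    have h := (T2 1 one_ne_zero).eventually_const_lt (show (n : ℝ) - ε < (n : ℝ) by linarith)
    obtain ⟨x, hx, hm⟩ := (h.and self_mem_nhdsWithin).exists
    obtain ⟨h1, h2, -, -⟩ := key x.1 1 x.2 hm.1 one_ne_zero hm.2
    exact ⟨_, h1, h2, hx⟩
end
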